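/- arXiv:1003.0028 — 2 statements merged into one kernel-verified Lean document; each statement's English description precedes it below -/
import Mathlib

section
/- For fixed τ > 0, κ > 0, b ≥ 0 and a fixed continuous initial history φ : [−τ, 0] → ℝ, the solution of the ENSO delay differential equation is unique: if h₁ and h₂ are both solutions on [0, ∞) with the same initial history φ, then h₁(t) = h₂(t) for all t ∈ [−τ, ∞). -/
open Real Set

/-- `h : ℝ → ℝ` is a solution of the ENSO delay differential equation
`h'(t) = -tanh (κ * h (t - τ)) + b * cos (2 π t)` on `[0, ∞)` with delay `τ`,
coupling `κ`, forcing amplitude `b` and initial history `φ` on `[-τ, 0]`. -/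
def IsSolution (τ κ b : ℝ) (φ h : ℝ → ℝ) : Prop :=
  ContinuousOn h (Set.Ici (-τ)) ∧
  (∀ t ∈ Set.Icc (-τ) (0 : ℝ), h t = φ t) ∧
  (∀ t > (0 : ℝ),
    HasDerivAt h (-Real.tanh (κ * h (t - τ)) + b * Real.cos (2 * π * t)) t) ∧
  HasDerivWithinAt h (-Real.tanh (κ * h ((0 : ℝ) - τ)) + b * Real.cos (2 * π * 0))
    (Set.Ici 0) 0

theorem IsSolution.hasDerivWithinAt {τ κ b : ℝ} {φ h : ℝ → ℝ} (hsol : IsSolution τ κ b φ h)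
    {t : ℝ} (ht : 0 ≤ t) :
    HasDerivWithinAt h (-Real.tanh (κ * h (t - τ)) + b * Real.cos (2 * π * t)) (Set.Ici t) t := by
  obtain rfl | ht := ht.eq_or_lt
  · exact hsol.2.2.2
  · exact (hsol.2.2.1 t ht).hasDerivWithinAt

/-- Method of steps: agreement on `[-τ, T]` extends to `[-τ, T + τ]`. -/
theorem IsSolution.eqOn_Icc_add {τ κ b : ℝ} {φ h₁ h₂ : ℝ → ℝ} (hτ : 0 ≤ τ)
    (hsol₁ : IsSolution τ κ b φ h₁) (hsol₂ : IsSolution τ κ b φ h₂) {T : ℝ}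
    (heq : Set.EqOn h₁ h₂ (Set.Icc (-τ) T)) : Set.EqOn h₁ h₂ (Set.Icc (-τ) (T + τ)) := by
  have history : ∀ t ∈ Set.Icc (-τ) 0, h₁ t = h₂ t := fun t ht =>
    (hsol₁.2.1 t ht).trans (hsol₂.2.1 t ht).symm
  intro t ht
  rcases le_total t 0 with ht0 | ht0
  · exact history t ⟨ht.1, ht0⟩
  have hsub : Set.Icc 0 (T + τ) ⊆ Set.Ici (-τ) := fun s hs => by
    simp only [Set.mem_Icc, Set.mem_Ici] at *
    linarith
  have hconst := constant_of_has_deriv_right_zero (f := fun s => h₁ s - h₂ s)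
    ((hsol₁.1.mono hsub).sub (hsol₂.1.mono hsub))
    (fun s hs => by
      have hdelay : h₁ (s - τ) = h₂ (s - τ) :=
        heq ⟨by linarith [hs.1], by linarith [hs.2]⟩
      have hderiv := (hsol₁.hasDerivWithinAt hs.1).sub (hsol₂.hasDerivWithinAt hs.1)
      rw [hdelay, sub_self] at hderiv
      exact hderiv) t ⟨ht0, ht.2⟩
  have hzero := history 0 ⟨by linarith, le_rfl⟩
  simp only [hzero, sub_self] at hconst
  exact sub_eq_zero.mp hconst

/-- Uniqueness of the solution of the ENSO DDE for a fixed continuous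
initial history. -/
theorem enso_dde_uniqueness (τ κ b : ℝ) (hτ : 0 < τ) (hκ : 0 < κ) (hb : 0 ≤ b)
    (φ : ℝ → ℝ) (hφ : ContinuousOn φ (Set.Icc (-τ) 0))
    (h₁ h₂ : ℝ → ℝ) (hsol₁ : IsSolution τ κ b φ h₁) (hsol₂ : IsSolution τ κ b φ h₂) :
    ∀ t ∈ Set.Ici (-τ), h₁ t = h₂ t := by
  have heq : ∀ n : ℕ, Set.EqOn h₁ h₂ (Set.Icc (-τ) (n * τ)) := by
    intro n
    induction n with
    | zero =>
      intro t ht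
      have ht' : t ∈ Set.Icc (-τ) 0 := by simpa using ht
      exact (hsol₁.2.1 t ht').trans (hsol₂.2.1 t ht').symm
    | succ n ih =>
      have hstep := hsol₁.eqOn_Icc_add hτ.le hsol₂ ih
      rwa [Nat.cast_succ, add_one_mul]
  intro t ht
  obtain ⟨n, hn⟩ := exists_nat_ge (t / τ)
  exact heq n ⟨ht, (div_le_iff₀ hτ).mp hn⟩
end

section
/- Let τ > 0, κ > 0, let φ : [−τ, 0] → ℝ be continuous, and let h₁, h₂ be the solutions of the ENSO delay differential equation on [0, ∞) with the same delay τ, coupling κ, and initial history φ, but with forcing amplitudes b₁ ≥ 0 and b₂ ≥ 0 respectively. Then for every T > 0, sup_{t ∈ [0, T]} |h₁(t) − h₂(t)| ≤ |b₁ − b₂| · T · e^{κT}. -/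
open Real Set

/-- The hyperbolic tangent is 1-Lipschitz. -/
theorem abs_tanh_sub_tanh_le (x y : ℝ) : |Real.tanh x - Real.tanh y| ≤ |x - y| := by
  have hd : ∀ z ∈ (Set.univ : Set ℝ),
      HasDerivWithinAt Real.tanh (1 / Real.cosh z ^ 2) Set.univ z := by
    intro z _
    have h := (Real.hasDerivAt_sinh z).div (Real.hasDerivAt_cosh z) (Real.cosh_pos z).ne'
    have hnum : Real.cosh z * Real.cosh z - Real.sinh z * Real.sinh z = 1 := by
      linarith [Real.cosh_sq z]
    rw [hnum] at h
    refine (h.congr_of_eventuallyEq ?_).hasDerivWithinAt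
    exact Filter.Eventually.of_forall fun w => Real.tanh_eq_sinh_div_cosh w
  have hb : ∀ z ∈ (Set.univ : Set ℝ), ‖1 / Real.cosh z ^ 2‖ ≤ 1 := by
    intro z _
    have h1 : 1 ≤ Real.cosh z ^ 2 := one_le_pow₀ (Real.one_le_cosh z)
    rw [Real.norm_of_nonneg (by positivity)]
    exact div_le_one_of_le₀ h1 (by positivity)
  simpa using convex_univ.norm_image_sub_le_of_norm_hasDerivWithin_le hd hb
    (Set.mem_univ y) (Set.mem_univ x)

/-- The right-hand side of the equation is Lipschitz in the delayed value and in the forcing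
amplitude. -/
theorem abs_neg_tanh_add_mul_cos_sub_le {κ b₁ b₂ : ℝ} (hκ : 0 ≤ κ) (x y s : ℝ) :
    |(-Real.tanh (κ * x) + b₁ * Real.cos s) - (-Real.tanh (κ * y) + b₂ * Real.cos s)|
      ≤ κ * |x - y| + |b₁ - b₂| := by
  have htanh : |Real.tanh (κ * y) - Real.tanh (κ * x)| ≤ κ * |x - y| := by
    refine (abs_tanh_sub_tanh_le _ _).trans_eq ?_
    rw [← mul_sub, abs_mul, abs_of_nonneg hκ, abs_sub_comm]
  have hcos : |(b₁ - b₂) * Real.cos s| ≤ |b₁ - b₂| := by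
    rw [abs_mul]
    exact mul_le_of_le_one_right (abs_nonneg _) (Real.abs_cos_le_one s)
  calc _ = |(Real.tanh (κ * y) - Real.tanh (κ * x)) + (b₁ - b₂) * Real.cos s| := by
        congr 1; ring
    _ ≤ _ := (abs_add_le _ _).trans (add_le_add htanh hcos)

namespace IsSolution

variable {τ κ b b₁ b₂ : ℝ} {φ h h₁ h₂ : ℝ → ℝ}

theorem hasDerivWithinAt_Ici (hsol : IsSolution τ κ b φ h) {t : ℝ} (ht : 0 ≤ t) :
    HasDerivWithinAt h (-Real.tanh (κ * h (t - τ)) + b * Real.cos (2 * π * t)) (Set.Ici t) t := by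
  rcases ht.eq_or_lt with rfl | ht
  · exact hsol.2.2.2
  · exact (hsol.2.2.1 t ht).hasDerivWithinAt

/-- Method of steps: on `[0, n τ]` the difference of two solutions with the same history is
bounded by `|b₁ - b₂| t exp (κ t)`. -/
theorem abs_sub_le_of_le_nat_mul (hτ : 0 < τ) (hκ : 0 < κ)
    (hsol₁ : IsSolution τ κ b₁ φ h₁) (hsol₂ : IsSolution τ κ b₂ φ h₂) (n : ℕ) :
    ∀ t ∈ Set.Icc (0 : ℝ) (n * τ), |h₁ t - h₂ t| ≤ |b₁ - b₂| * t * Real.exp (κ * t) := by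
  have hist : ∀ t ∈ Set.Icc (-τ) (0 : ℝ), h₁ t - h₂ t = 0 := fun t ht => by
    rw [hsol₁.2.1 t ht, hsol₂.2.1 t ht, sub_self]
  induction n with
  | zero =>
    intro t ht
    obtain rfl : t = 0 := le_antisymm (by simpa using ht.2) ht.1
    simp [hist 0 ⟨by linarith, le_rfl⟩]
  | succ n ih =>
    have hB : ∀ t : ℝ, HasDerivAt (fun t => |b₁ - b₂| * t * Real.exp (κ * t))
        (|b₁ - b₂| * Real.exp (κ * t) + κ * (|b₁ - b₂| * t * Real.exp (κ * t))) t := by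
      intro t
      have hexp : HasDerivAt (fun t => Real.exp (κ * t)) (Real.exp (κ * t) * κ) t := by
        simpa using ((hasDerivAt_id t).const_mul κ).exp
      have hlin : HasDerivAt (fun t => |b₁ - b₂| * t) |b₁ - b₂| t := by
        simpa using (hasDerivAt_id t).const_mul |b₁ - b₂|
      exact (hlin.mul hexp).congr_deriv (by ring)
    have hcont : ContinuousOn (fun t => h₁ t - h₂ t) (Set.Icc 0 ((n + 1 : ℕ) * τ)) :=
      (hsol₁.1.sub hsol₂.1).mono fun t ht => by
        have := ht.1
        simp only [Set.mem_Ici]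
        linarith
    intro t ht
    refine image_norm_le_of_norm_deriv_right_le_deriv_boundary hcont
      (fun s hs => (hsol₁.hasDerivWithinAt_Ici hs.1).sub (hsol₂.hasDerivWithinAt_Ici hs.1))
      (by simp [hist 0 ⟨by linarith, le_rfl⟩]) hB (fun s hs => ?_) ht
    have hs0 : 0 ≤ s := hs.1
    refine (abs_neg_tanh_add_mul_cos_sub_le hκ.le _ _ _).trans ?_
    have hexp : |b₁ - b₂| ≤ |b₁ - b₂| * Real.exp (κ * s) :=
      le_mul_of_one_le_right (abs_nonneg _) (Real.one_le_exp (by positivity))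
    have hdelay : |h₁ (s - τ) - h₂ (s - τ)| ≤ |b₁ - b₂| * s * Real.exp (κ * s) := by
      rcases le_total s τ with hsτ | hsτ
      · rw [hist _ ⟨by linarith, by linarith⟩, abs_zero]
        positivity
      · have hsn : s - τ ≤ n * τ := by
          have := hs.2
          push_cast at this
          linarith
        refine (ih _ ⟨by linarith, hsn⟩).trans ?_
        have : s - τ ≤ s := by linarith
        gcongr
    linarith [mul_le_mul_of_nonneg_left hdelay hκ.le]

end IsSolution

/-- Continuous dependence of solutions of the ENSO DDE on the forcing
amplitude `b`, on finite time intervals. -/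
theorem enso_dde_continuous_dependence_forcing (τ κ b₁ b₂ : ℝ)
    (hτ : 0 < τ) (hκ : 0 < κ) (hb₁ : 0 ≤ b₁) (hb₂ : 0 ≤ b₂)
    (φ : ℝ → ℝ) (hφ : ContinuousOn φ (Set.Icc (-τ) 0))
    (h₁ h₂ : ℝ → ℝ) (hsol₁ : IsSolution τ κ b₁ φ h₁) (hsol₂ : IsSolution τ κ b₂ φ h₂) :
    ∀ T > (0 : ℝ), ∀ t ∈ Set.Icc (0 : ℝ) T,
      |h₁ t - h₂ t| ≤ |b₁ - b₂| * T * Real.exp (κ * T) := by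
  intro T _ t ht
  obtain ⟨n, hn⟩ := exists_nat_ge (t / τ)
  have htn : t ≤ n * τ := (div_le_iff₀ hτ).mp hn
  refine (IsSolution.abs_sub_le_of_le_nat_mul hτ hκ hsol₁ hsol₂ n t ⟨ht.1, htn⟩).trans ?_
  have htT : t ≤ T := ht.2
  have ht0 : 0 ≤ t := ht.1
  gcongr
end
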